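/- Let ℓ ≥ 1 and k ≥ 2 be integers. Then (i) for every ε > 0 there exists N such that for all n ≥ N, ex(n, T_ℓ, B_k) ≥ n^{ℓ+2−ε}, and (ii) ex(n, T_ℓ, B_k) = o(n^{ℓ+2}), i.e., ex(n, T_ℓ, B_k)/n^{ℓ+2} tends to 0 as n → ∞. -/

import Mathlib

open SimpleGraph Finset Filter

/-- The number of copies of `H` in `G`, i.e. the number of subgraphs of `G`
whose underlying graph is isomorphic to `H`. -/
noncomputable def copyCount {α β : Type*} (H : SimpleGraph α) (G : SimpleGraph β) : ℕ :=
  Nat.card {G' : G.Subgraph // Nonempty (H ≃g G'.coe)}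

/-- `G` is `F`-free: `G` contains no subgraph isomorphic to `F`. -/
def GFree {α β : Type*} (F : SimpleGraph α) (G : SimpleGraph β) : Prop :=
  ¬ ∃ f : α ↪ β, ∀ a b, F.Adj a b → G.Adj (f a) (f b)

/-- The generalized Turán number `ex(n, H, F)`: the maximal number of copies of `H`
in an `F`-free graph on `n` vertices. -/
noncomputable def exN {α β : Type*} (n : ℕ) (H : SimpleGraph α) (F : SimpleGraph β) : ℕ :=
  sSup {m | ∃ G : SimpleGraph (Fin n), GFree F G ∧ copyCount H G = m}

/-- The star `S_r` on `r` vertices: vertex `0` is joined to all other vertices. -/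
def starGraph (r : ℕ) : SimpleGraph (Fin r) :=
  SimpleGraph.fromRel (fun i _ => i.val = 0)

/-- The matching `M_k` with `k` disjoint edges `{2i, 2i+1}`. -/
def matchingGraph (k : ℕ) : SimpleGraph (Fin (2 * k)) :=
  SimpleGraph.fromRel (fun i j => i.val / 2 = j.val / 2)

def friendshipGraph (n : ℕ) : SimpleGraph (Fin n) :=
  SimpleGraph.fromRel (fun i j => i.val = 0 ∨ (i.val + 1) / 2 = (j.val + 1) / 2)

def pawGraph : SimpleGraph (Fin 4) :=
  SimpleGraph.fromRel (fun i j => (i.val ≤ 2 ∧ j.val ≤ 2) ∨ i.val = 0)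

def triangleWithLeaves (l : ℕ) : SimpleGraph (Fin (l + 3)) :=
  SimpleGraph.fromRel (fun i j => (i.val ≤ 2 ∧ j.val ≤ 2) ∨ i.val = 0)

def bookGraph (k : ℕ) : SimpleGraph (Fin (k + 2)) :=
  SimpleGraph.fromRel (fun i _ => i.val ≤ 1)

def triangleFactor (n : ℕ) : SimpleGraph (Fin n) :=
  SimpleGraph.fromRel (fun i j => i.val / 3 = j.val / 3)

def splitGraph (n a : ℕ) : SimpleGraph (Fin n) :=
  SimpleGraph.fromRel (fun i j => i.val < a ∧ ¬ j.val < a)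

def cliquePlusPendant (r : ℕ) : SimpleGraph (Fin (r + 1)) :=
  SimpleGraph.fromRel (fun i j => (i.val < r ∧ j.val < r) ∨ i.val = 0)

lemma copyCount_le_card_copy {α β : Type*} [Finite α] [Finite β]
    (H : SimpleGraph α) (G : SimpleGraph β) :
    _root_.copyCount H G ≤ Nat.card (SimpleGraph.Copy H G) := by
  have : Finite (SimpleGraph.Copy H G) := DFunLike.finite _
  refine Nat.card_le_card_of_surjective
    (fun f => (⟨f.toSubgraph, ⟨f.isoToSubgraph⟩⟩ :
      {G' : G.Subgraph // Nonempty (H ≃g G'.coe)})) ?_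
  rintro ⟨G', hG'⟩
  obtain ⟨f, -, hf⟩ := Copy.toSubgraph_surjOn hG'
  exact ⟨f, Subtype.ext hf⟩

lemma card_copy_le_mul_copyCount {r : ℕ} {β : Type*} [Fintype β]
    (H : SimpleGraph (Fin r)) (G : SimpleGraph β) :
    Nat.card (SimpleGraph.Copy H G) ≤ r ^ r * _root_.copyCount H G := by
  classical
  have : Finite (SimpleGraph.Copy H G) := DFunLike.finite _
  have hfin : Finite G.Subgraph := inferInstance
  let S := {G' : G.Subgraph // Nonempty (H ≃g G'.coe)}
  let e : ∀ G' : S, H ≃g G'.1.coe := fun G' => G'.2.some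
  have hmem : ∀ (f : SimpleGraph.Copy H G) (i : Fin r), f i ∈ f.toSubgraph.verts := by
    intro f i
    simp [Copy.toSubgraph]
  let p : SimpleGraph.Copy H G → S := fun f => ⟨f.toSubgraph, ⟨f.isoToSubgraph⟩⟩
  let F : SimpleGraph.Copy H G → (Fin r → Fin r) × S := fun f =>
    (fun i => (e (p f)).symm ⟨f i, hmem f i⟩, p f)
  have hF : Function.Injective F := by
    intro f g hfg
    have h2 : p f = p g := congrArg Prod.snd hfg
    have h1 : ∀ i, (F f).1 i = (F g).1 i := fun i => by rw [hfg]
    apply DFunLike.ext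
    intro i
    have h3 : ∀ f : SimpleGraph.Copy H G, ((e (p f)) ((F f).1 i)).1 = f i := fun f => by
      simp [F]
    rw [← h3 f, ← h3 g, h1 i]
    have key : ∀ (a b : S) (x : Fin r), a = b → ((e a x).1 : β) = (e b x).1 := by
      rintro a b x rfl; rfl
    exact key _ _ _ h2
  have := Nat.card_le_card_of_injective F hF
  simpa [Nat.card_prod, S, _root_.copyCount] using this

lemma GFree.card_commonNeighbors_lt {k : ℕ} {β : Type*} [Fintype β] [DecidableEq β]
    {G : SimpleGraph β} [DecidableRel G.Adj] (hG : GFree (bookGraph k) G) {a b : β}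
    (hab : G.Adj a b) : #{c | G.Adj a c ∧ G.Adj b c} < k := by
  by_contra! hk
  obtain ⟨g⟩ : Nonempty (Fin k ↪ {c // G.Adj a c ∧ G.Adj b c}) := by
    rw [Function.Embedding.nonempty_iff_card_le, Fintype.card_fin, Fintype.card_subtype]
    exact hk
  let f : Fin (k + 2) → β := Fin.cons a (Fin.cons b (fun i => (g i).1))
  have hf : Function.Injective f := by
    simp only [f, Fin.cons_injective_iff, Set.mem_range, not_exists]
    refine ⟨fun i => ?_, fun i => (g i).2.2.ne', fun i j h => g.injective (Subtype.ext h)⟩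
    induction i using Fin.cases with
    | zero => simpa using hab.ne'
    | succ i => simpa using (g i).2.1.ne'
  refine hG ⟨⟨f, hf⟩, fun i j => ?_⟩
  have h := fun i => (g i).2.1
  have h' := fun i => (g i).2.2
  induction i using Fin.cases with
  | zero =>
    induction j using Fin.cases with
    | zero => simp
    | succ j =>
      induction j using Fin.cases with
      | zero => simp [f, hab]
      | succ j => simp [f, h]
  | succ i =>
    induction i using Fin.cases with
    | zero =>
      induction j using Fin.cases with
      | zero => simp [f, hab.symm]
      | succ j =>
        induction j using Fin.cases with
        | zero => simp
        | succ j => simp [f, h']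
    | succ i =>
      induction j using Fin.cases with
      | zero => simp [f, (h i).symm]
      | succ j =>
        induction j using Fin.cases with
        | zero => simp [f, (h' i).symm]
        | succ j => simp [f, bookGraph]

lemma SimpleGraph.LocallyLinear.gFree_bookGraph {k : ℕ} (hk : 2 ≤ k) {β : Type*}
    {G : SimpleGraph β} (hG : G.LocallyLinear) : GFree (bookGraph k) G := by
  classical
  rintro ⟨f, hf⟩
  have h01 := hf ⟨0, by lia⟩ ⟨1, by lia⟩ (by simp [bookGraph])
  have h02 := hf ⟨0, by lia⟩ ⟨2, by lia⟩ (by simp [bookGraph])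
  have h03 := hf ⟨0, by lia⟩ ⟨3, by lia⟩ (by simp [bookGraph])
  have h12 := hf ⟨1, by lia⟩ ⟨2, by lia⟩ (by simp [bookGraph])
  have h13 := hf ⟨1, by lia⟩ ⟨3, by lia⟩ (by simp [bookGraph])
  have h23 : f ⟨2, by lia⟩ ≠ f ⟨3, by lia⟩ := fun h => by simpa using f.injective h
  refine hG.edgeDisjointTriangles.eq
    (a := {f ⟨0, by lia⟩, f ⟨1, by lia⟩, f ⟨2, by lia⟩})
    (b := {f ⟨0, by lia⟩, f ⟨1, by lia⟩, f ⟨3, by lia⟩})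
    (is3Clique_triple_iff.2 ⟨h01, h02, h12⟩) (is3Clique_triple_iff.2 ⟨h01, h03, h13⟩)
    (Set.Nontrivial.not_subsingleton ⟨f ⟨0, by lia⟩, by simp, f ⟨1, by lia⟩, by simp, h01.ne⟩)
    |> fun h => ?_
  have : f ⟨2, by lia⟩ ∈ ({f ⟨0, by lia⟩, f ⟨1, by lia⟩, f ⟨3, by lia⟩} : Finset β) := by
    rw [← h]; simp
  simp [h23] at this

lemma GFree.card_cliqueFinset_le {k : ℕ} {β : Type*} [Fintype β] [DecidableEq β]
    {G : SimpleGraph β} [DecidableRel G.Adj] (hG : GFree (bookGraph k) G) (E : Finset (Sym2 β))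
    (hE : E ⊆ G.edgeFinset)
    (hcover : ∀ s ∈ G.cliqueFinset 3, ∃ e ∈ E, e ∈ s.sym2) :
    #(G.cliqueFinset 3) ≤ #E * k := by
  calc
    _ ≤ #(E.biUnion fun e => {s ∈ G.cliqueFinset 3 | e ∈ s.sym2}) := by
      refine card_le_card fun s hs => ?_
      obtain ⟨e, he, hes⟩ := hcover s hs
      exact mem_biUnion.2 ⟨e, he, mem_filter.2 ⟨hs, hes⟩⟩
    _ ≤ #E * k := by
      refine card_biUnion_le_card_mul _ _ _ fun e he => ?_
      have hadj := mem_edgeFinset.1 (hE he)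
      induction e with | _ a b =>
      rw [mem_edgeSet] at hadj
      refine le_trans ?_ (hG.card_commonNeighbors_lt hadj).le
      refine le_trans (card_le_card ?_)
        (card_image_le (s := {c | G.Adj a c ∧ G.Adj b c}) (f := fun c => {a, b, c}))
      intro s hs
      rw [mem_filter, mem_cliqueFinset_iff, mk_mem_sym2_iff] at hs
      obtain ⟨hs, ha, hb⟩ := hs
      have hcard : #(s \ {a, b}) = 1 := by
        rw [card_sdiff_of_subset (by simp [insert_subset_iff, ha, hb]), hs.card_eq,
          card_pair hadj.ne]
      obtain ⟨c, hc⟩ := card_eq_one.1 hcard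
      have hcs : c ∈ s \ {a, b} := by simp [hc]
      simp only [Finset.mem_sdiff, Finset.mem_insert, Finset.mem_singleton, not_or] at hcs
      refine mem_image.2 ⟨c, ?_, ?_⟩
      · simp [hs.isClique ha hcs.1 (Ne.symm hcs.2.1), hs.isClique hb hcs.1 (Ne.symm hcs.2.2)]
      · have : s = {a, b} ∪ s \ {a, b} := by
          rw [union_sdiff_of_subset (by simp [insert_subset_iff, ha, hb])]
        rw [this, hc]; ext; simp

lemma card_copy_triangleWithLeaves_le {l : ℕ} {β : Type*} [Fintype β] [DecidableEq β]
    (G : SimpleGraph β) [DecidableRel G.Adj] :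
    Nat.card (SimpleGraph.Copy (triangleWithLeaves l) G) ≤
      27 * #(G.cliqueFinset 3) * Fintype.card β ^ l := by
  let T : Finset (β × β × β) := (G.cliqueFinset 3).biUnion fun s => s ×ˢ s ×ˢ s
  have hT : #T ≤ 27 * #(G.cliqueFinset 3) := by
    rw [mul_comm]
    refine card_biUnion_le_card_mul _ _ _ fun s hs => ?_
    simp [(mem_cliqueFinset_iff.1 hs).card_eq]
  have hadj : ∀ i j : Fin (l + 3), i ≠ j → i.val ≤ 2 → j.val ≤ 2 →
      (triangleWithLeaves l).Adj i j := by
    intro i j hij hi hj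
    simp [triangleWithLeaves, hij, hi, hj]
  let i₁ : Fin (l + 3) := ⟨1, by lia⟩
  let i₂ : Fin (l + 3) := ⟨2, by lia⟩
  have hmem : ∀ f : SimpleGraph.Copy (triangleWithLeaves l) G, (f 0, f i₁, f i₂) ∈ T := by
    intro f
    refine mem_biUnion.2 ⟨{f 0, f i₁, f i₂}, ?_, by simp⟩
    rw [mem_cliqueFinset_iff, is3Clique_triple_iff]
    exact ⟨f.toHom.map_adj (hadj _ _ (by simp [i₁]) (by simp) (by simp [i₁])),
      f.toHom.map_adj (hadj _ _ (by simp [i₂, Fin.ext_iff]) (by simp) (by simp [i₂])),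
      f.toHom.map_adj (hadj _ _ (by simp [i₁, i₂, Fin.ext_iff]) (by simp [i₁]) (by simp [i₂]))⟩
  let F : SimpleGraph.Copy (triangleWithLeaves l) G → T × (Fin l → β) := fun f =>
    (⟨_, hmem f⟩, fun i => f i.succ.succ.succ)
  have hF : Function.Injective F := by
    intro f g h
    simp only [F, Prod.mk.injEq, Subtype.mk.injEq] at h
    obtain ⟨⟨h0, h1, h2⟩, h⟩ := h
    apply DFunLike.ext
    intro i
    induction i using Fin.cases with
    | zero => exact h0
    | succ i =>
      induction i using Fin.cases with
      | zero => exact h1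
      | succ i =>
        induction i using Fin.cases with
        | zero => exact h2
        | succ i => exact congrFun h i
  refine (Nat.card_le_card_of_injective F hF).trans ?_
  rw [Nat.card_prod, Nat.card_eq_fintype_card, Nat.card_eq_fintype_card, Fintype.card_coe,
    Fintype.card_fun, Fintype.card_fin]
  exact Nat.mul_le_mul_right _ hT

lemma mul_pow_le_card_copy_triangleWithLeaves {l m : ℕ} {β : Type*} [Fintype β] [DecidableEq β]
    (G : SimpleGraph β) [DecidableRel G.Adj]
    (hG : ∀ v w, G.Adj v w → ∃ u, G.Adj v u ∧ G.Adj w u)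
    (hm : Fintype.card β * m ≤ #G.edgeFinset) :
    #G.edgeFinset * (m - 2 + 1 - l) ^ l ≤
      Nat.card (SimpleGraph.Copy (triangleWithLeaves l) G) := by
  let D : Finset G.Dart := {d | m ≤ G.degree d.fst}
  have hD : #G.edgeFinset ≤ #D := by
    have h1 : #D + #{d : G.Dart | ¬ m ≤ G.degree d.fst} = 2 * #G.edgeFinset := by
      rw [card_filter_add_card_filter_not, card_univ, dart_card_eq_twice_card_edges]
    have h2 : #{d : G.Dart | ¬ m ≤ G.degree d.fst} ≤ Fintype.card β * m := by
      rw [card_eq_sum_card_fiberwise (f := fun d : G.Dart => d.fst) (t := univ) (by simp)]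
      rw [← card_univ, ← smul_eq_mul]
      refine sum_le_card_nsmul _ _ _ fun v _ => ?_
      by_cases hv : m ≤ G.degree v
      · rw [card_eq_zero.2]
        · simp
        · ext d; simp; rintro h rfl; lia
      · refine le_trans ?_ (not_le.1 hv).le
        rw [← dart_fst_fiber_card_eq_degree]
        exact card_le_card fun d => by simp
    lia
  choose! u hu using hG
  let X : G.Dart → Type _ := fun d =>
    {x // G.Adj d.fst x ∧ x ≠ d.snd ∧ x ≠ u d.fst d.snd}
  have hX : ∀ d ∈ D, (m - 2 + 1 - l) ^ l ≤ Fintype.card (Fin l ↪ X d) := by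
    intro d hd
    rw [Fintype.card_embedding_eq, Fintype.card_fin]
    refine le_trans ?_ (Nat.pow_sub_le_descFactorial _ _)
    have hd' : m ≤ G.degree d.fst := (mem_filter.1 hd).2
    have : G.degree d.fst - 2 ≤ Fintype.card (X d) := by
      rw [Fintype.card_subtype]
      have h1 : ({x | G.Adj d.fst x ∧ x ≠ d.snd ∧ x ≠ u d.fst d.snd} : Finset β)
          = G.neighborFinset d.fst \ {d.snd, u d.fst d.snd} := by
        ext; simp
      rw [h1, ← card_neighborFinset_eq_degree]
      refine le_trans (Nat.sub_le_sub_left ?_ _) (le_card_sdiff _ _)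
      exact card_le_two
    gcongr
    lia
  have hleaf : ∀ (i : Fin (l + 2)) (j : Fin l),
      ¬ (triangleWithLeaves l).Adj i.succ j.succ.succ.succ := by
    simp [triangleWithLeaves]
  let F : (Σ d : D, Fin l ↪ X d.1) → SimpleGraph.Copy (triangleWithLeaves l) G := fun p =>
    { toHom :=
        { toFun := (Fin.cons p.1.1.fst (Fin.cons p.1.1.snd
            (Fin.cons (u p.1.1.fst p.1.1.snd) fun i => (p.2 i).1)) : Fin (l + 3) → β)
          map_rel' := by
            have h0 := p.1.1.adj
            have h1 := (hu _ _ h0).1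
            have h2 := (hu _ _ h0).2
            have h3 := fun i => (p.2 i).2.1
            intro i j
            induction i using Fin.cases with
            | zero =>
              induction j using Fin.cases with
              | zero => exact fun h => (h.ne rfl).elim
              | succ j =>
                induction j using Fin.cases with
                | zero => exact fun _ => h0
                | succ j =>
                  induction j using Fin.cases with
                  | zero => exact fun _ => h1
                  | succ j => exact fun _ => h3 j
            | succ i =>
              induction i using Fin.cases with
              | zero =>
                induction j using Fin.cases with
                | zero => exact fun _ => h0.symm
                | succ j =>
                  induction j using Fin.cases with
                  | zero => exact fun h => (h.ne rfl).elim
                  | succ j =>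
                    induction j using Fin.cases with
                    | zero => exact fun _ => h2
                    | succ j => exact fun h => (hleaf _ _ h).elim
              | succ i =>
                induction i using Fin.cases with
                | zero =>
                  induction j using Fin.cases with
                  | zero => exact fun _ => h1.symm
                  | succ j =>
                    induction j using Fin.cases with
                    | zero => exact fun _ => h2.symm
                    | succ j =>
                      induction j using Fin.cases with
                      | zero => exact fun h => (h.ne rfl).elim
                      | succ j => exact fun h => (hleaf _ _ h).elim
                | succ i =>
                  induction j using Fin.cases with
                  | zero => exact fun _ => (h3 i).symm
                  | succ j => exact fun h => (hleaf _ _ h.symm).elim }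
      injective' := by
        change Function.Injective (Fin.cons p.1.1.fst (Fin.cons p.1.1.snd
            (Fin.cons (u p.1.1.fst p.1.1.snd) fun i => (p.2 i).1)) : Fin (l + 3) → β)
        simp only [Fin.cons_injective_iff, Set.mem_range, not_exists]
        refine ⟨fun i => ?_, fun i => ?_, fun i => (p.2 i).2.2.2,
          fun i j h => p.2.injective (Subtype.ext h)⟩
        · induction i using Fin.cases with
          | zero => simp
          | succ i =>
            induction i using Fin.cases with
            | zero => exact (hu _ _ p.1.1.adj).1.ne'
            | succ i => simpa using (p.2 i).2.1.ne'
        · induction i using Fin.cases with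
          | zero => simpa using (hu _ _ p.1.1.adj).2.ne'
          | succ i => simpa using (p.2 i).2.2.1 }
  have hF : Function.Injective F := by
    rintro ⟨⟨d, hd⟩, g⟩ ⟨⟨d', hd'⟩, g'⟩ h
    have h0 : d.fst = d'.fst := DFunLike.congr_fun h (0 : Fin (l + 3))
    have h1 : d.snd = d'.snd := DFunLike.congr_fun h (1 : Fin (l + 3))
    obtain rfl : d = d' := Dart.ext _ _ (Prod.ext h0 h1)
    congr 1
    ext i
    exact DFunLike.congr_fun h (i.succ.succ.succ : Fin (l + 3))
  have : Finite (SimpleGraph.Copy (triangleWithLeaves l) G) := DFunLike.finite _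
  refine le_trans ?_ (Nat.card_le_card_of_injective F hF)
  rw [Nat.card_eq_fintype_card, Fintype.card_sigma]
  calc
    _ ≤ #D * (m - 2 + 1 - l) ^ l := by gcongr
    _ = ∑ d : D, (m - 2 + 1 - l) ^ l := by simp
    _ ≤ _ := sum_le_sum fun d _ => hX d.1 d.2

lemma exN_le {α β : Type*} {n M : ℕ} {H : SimpleGraph α} {F : SimpleGraph β}
    (h : ∀ G : SimpleGraph (Fin n), GFree F G → _root_.copyCount H G ≤ M) : exN n H F ≤ M := by
  refine csSup_le' ?_
  rintro _ ⟨G, hG, rfl⟩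
  exact h G hG

lemma GFree.copyCount_le_exN {α β : Type*} {n : ℕ} {H : SimpleGraph α} {F : SimpleGraph β}
    {G : SimpleGraph (Fin n)} (hG : GFree F G) : _root_.copyCount H G ≤ exN n H F := by
  refine le_csSup (Set.Finite.bddAbove ?_) ⟨G, hG, rfl⟩
  refine (Set.finite_range fun G : SimpleGraph (Fin n) => _root_.copyCount H G).subset ?_
  rintro _ ⟨G, -, rfl⟩
  exact ⟨G, rfl⟩

lemma exists_forall_card_cliqueFinset_le (k : ℕ) {δ : ℝ} (hδ : 0 < δ) :
    ∃ N : ℕ, ∀ n ≥ N, ∀ (G : SimpleGraph (Fin n)) [DecidableRel G.Adj],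
      GFree (bookGraph k) G → (#(G.cliqueFinset 3) : ℝ) ≤ δ * n ^ 2 := by
  have hη : 0 < δ / (k + 1) := by positivity
  have hb := triangleRemovalBound_pos hη
  set b := triangleRemovalBound (δ / (k + 1))
  obtain ⟨N, hN⟩ := exists_nat_gt (k / b)
  refine ⟨N + 1, fun n hn G _ hG => ?_⟩
  have hn0 : (0 : ℝ) < n := by exact_mod_cast (by lia : 0 < n)
  have hkn : (k : ℝ) < b * n := by
    rw [div_lt_iff₀' hb] at hN
    have : (N : ℝ) ≤ n := by exact_mod_cast (by lia : N ≤ n)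
    exact hN.trans_le (by gcongr)
  have hcoarse : (#(G.cliqueFinset 3) : ℝ) ≤ n ^ 2 * k := by
    have h1 := hG.card_cliqueFinset_le G.edgeFinset subset_rfl fun s hs => by
      obtain ⟨a, b, c, hab, -, -, rfl⟩ := is3Clique_iff.1 (mem_cliqueFinset_iff.1 hs)
      exact ⟨s(a, b), by simpa using hab, by simp⟩
    have h2 : #G.edgeFinset ≤ n ^ 2 :=
      (card_edgeFinset_le_card_choose_two).trans (by simpa using Nat.choose_le_pow n 2)
    exact_mod_cast h1.trans (Nat.mul_le_mul_right _ h2)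
  obtain ⟨G', hle, _, hcard, hfree⟩ := triangle_removal (G := G) (ε := δ / (k + 1)) (by
    rw [Fintype.card_fin]
    calc
      _ ≤ _ := hcoarse
      _ < (n : ℝ) ^ 2 * (b * n) := by gcongr
      _ = _ := by ring)
  have hcover := hG.card_cliqueFinset_le (G.edgeFinset \ G'.edgeFinset) sdiff_subset
    fun s hs => by
      rw [mem_cliqueFinset_iff] at hs
      by_contra! hs'
      refine hfree s ⟨fun a ha b hb hab => ?_, hs.card_eq⟩
      by_contra hab'
      exact hs' s(a, b) (by simp [hs.isClique ha hb hab, hab']) (mk_mem_sym2_iff.2 ⟨ha, hb⟩)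
  rw [card_sdiff_of_subset (edgeFinset_mono hle)] at hcover
  have hsub := card_le_card (edgeFinset_mono hle)
  rw [Fintype.card_fin] at hcard
  push_cast at hcard
  calc
    (#(G.cliqueFinset 3) : ℝ) ≤ (#G.edgeFinset - #G'.edgeFinset : ℝ) * k := by
      rw [← Nat.cast_sub hsub]; exact_mod_cast hcover
    _ ≤ δ / (k + 1) * n ^ 2 * (k + 1) := by gcongr; linarith
    _ = δ * n ^ 2 := by field_simp

lemma tendsto_exN_triangleWithLeaves_bookGraph (l k : ℕ) :
    Tendsto (fun n : ℕ =>
        (exN n (triangleWithLeaves l) (bookGraph k) : ℝ) / (n : ℝ) ^ (l + 2))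
      atTop (nhds 0) := by
  classical
  rw [Metric.tendsto_atTop]
  intro ε hε
  obtain ⟨N, hN⟩ := exists_forall_card_cliqueFinset_le k (show 0 < ε / 54 by positivity)
  refine ⟨N + 1, fun n hn => ?_⟩
  have hn0 : (0 : ℝ) < n := by exact_mod_cast (by lia : 0 < n)
  rw [Real.dist_0_eq_abs, abs_of_nonneg (by positivity), div_lt_iff₀ (by positivity)]
  have hpos : 0 < ε * (n : ℝ) ^ (l + 2) := by positivity
  have h : exN n (triangleWithLeaves l) (bookGraph k) ≤ ⌊ε * (n : ℝ) ^ (l + 2) / 2⌋₊ := by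
    refine exN_le fun G hG => Nat.le_floor ?_
    have h1 := (copyCount_le_card_copy _ G).trans (card_copy_triangleWithLeaves_le (l := l) G)
    rw [Fintype.card_fin] at h1
    have h2 := hN n (by lia) G hG
    calc
      (_root_.copyCount (triangleWithLeaves l) G : ℝ)
        ≤ 27 * #(G.cliqueFinset 3) * n ^ l := by exact_mod_cast h1
      _ ≤ 27 * (ε / 54 * n ^ 2) * n ^ l := by gcongr
      _ = _ := by ring
  have h' := (Nat.le_floor_iff (by positivity)).1 h
  linarith

lemma eventually_rpow_le_ruzsaSzemerediNumberNat {δ : ℝ} (hδ : 0 < δ) :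
    ∀ᶠ n : ℕ in atTop, (n : ℝ) ^ (2 - δ) ≤ ruzsaSzemerediNumberNat n := by
  obtain ⟨C, hC, h⟩ := ruzsaSzemerediNumberNat_asymptotic_lower_bound.exists_pos
  have hlog : Tendsto (fun n : ℕ => √(Real.log n)) atTop atTop :=
    Real.tendsto_sqrt_atTop.comp (Real.tendsto_log_atTop.comp tendsto_natCast_atTop_atTop)
  filter_upwards [h.bound, eventually_gt_atTop 0,
    hlog.eventually_ge_atTop ((4 + |Real.log C|) / δ), hlog.eventually_ge_atTop 1] with n hn h0 h1 h2
  have hn0 : (0 : ℝ) < n := by exact_mod_cast h0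
  rw [Real.norm_of_nonneg (by positivity), Real.norm_of_nonneg (by positivity)] at hn
  refine le_of_mul_le_mul_left (le_trans ?_ hn) hC
  have hsq : √(Real.log n) ^ 2 = Real.log n := by
    refine Real.sq_sqrt (le_of_not_gt fun hneg => ?_)
    rw [Real.sqrt_eq_zero_of_nonpos hneg.le] at h2
    linarith
  set t := √(Real.log n)
  have h3 : C ≤ Real.exp |Real.log C| := by
    rw [← Real.log_le_iff_le_exp hC]; exact le_abs_self _
  have hpow : (n : ℝ) ^ 2 = Real.exp (2 * t ^ 2) := by
    rw [hsq, ← Real.rpow_natCast, Real.rpow_def_of_pos hn0]; push_cast; ring_nf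
  calc
    _ ≤ Real.exp |Real.log C| * Real.exp (t ^ 2 * (2 - δ)) := by
      rw [Real.rpow_def_of_pos hn0, hsq]; gcongr
    _ ≤ _ := by
      rw [hpow, ← Real.exp_add, ← Real.exp_add, Real.exp_le_exp]
      rw [div_le_iff₀ hδ] at h1
      nlinarith [abs_nonneg (Real.log C), mul_le_mul_of_nonneg_left h1 (by linarith : (0 : ℝ) ≤ t),
        mul_nonneg (abs_nonneg (Real.log C)) (sub_nonneg.2 h2)]

lemma eventually_rpow_le_exN_triangleWithLeaves_bookGraph (l : ℕ) {k : ℕ} (hk : 2 ≤ k)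
    {ε : ℝ} (hε : 0 < ε) :
    ∀ᶠ n : ℕ in atTop,
      (n : ℝ) ^ ((l : ℝ) + 2 - ε) ≤ (exN n (triangleWithLeaves l) (bookGraph k) : ℝ) := by
  obtain ⟨δ, hδ, hδ1, hδε⟩ : ∃ δ : ℝ, 0 < δ ∧ δ ≤ 1 / 2 ∧ (l + 1) * δ ≤ ε / 2 := by
    refine ⟨min (1 / 2) (ε / 2 / (l + 1)), by positivity, min_le_left _ _, ?_⟩
    rw [← le_div_iff₀' (by positivity)]
    exact min_le_right _ _
  have hpow {a : ℝ} (ha : 0 < a) (c : ℝ) : ∀ᶠ n : ℕ in atTop, c ≤ (n : ℝ) ^ a :=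
    ((tendsto_rpow_atTop ha).comp tendsto_natCast_atTop_atTop).eventually_ge_atTop c
  filter_upwards [eventually_rpow_le_ruzsaSzemerediNumberNat hδ, eventually_ge_atTop 1,
    hpow (half_pos hε) (((l + 3) ^ (l + 3) : ℕ) : ℝ), hpow one_half_pos (l + 2)] with n hR hn1 hC hl
  have hn0 : (0 : ℝ) < n := by exact_mod_cast hn1
  have hn1' : (1 : ℝ) ≤ n := by exact_mod_cast hn1
  obtain ⟨G, _, hcard, hG⟩ := ruzsaSzemerediNumber_spec (α := Fin n)
  change _ = ruzsaSzemerediNumberNat n at hcard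
  set R := ruzsaSzemerediNumberNat n
  have hedge : #G.edgeFinset = 3 * R := by rw [hG.card_edgeFinset, hcard]
  have hcommon : ∀ v w, G.Adj v w → ∃ u, G.Adj v u ∧ G.Adj w u := by
    intro v w hvw
    obtain ⟨s, hs, hv, hw⟩ := hG.2 hvw
    obtain ⟨u, hu, huv⟩ := Finset.exists_mem_notMem_of_card_lt_card
      (s := {v, w}) (t := s) (by rw [hs.card_eq, card_pair hvw.ne]; simp)
    simp only [mem_insert, mem_singleton, not_or] at huv
    exact ⟨u, hs.isClique hv hu (Ne.symm huv.1), hs.isClique hw hu (Ne.symm huv.2)⟩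
  have hcount := mul_pow_le_card_copy_triangleWithLeaves (l := l) (m := 3 * R / n) G hcommon (by
    rw [hedge, Fintype.card_fin]; exact Nat.mul_div_le _ _)
  have hfinal := (hcount.trans (card_copy_le_mul_copyCount _ G)).trans
    (Nat.mul_le_mul_left _ (hG.gFree_bookGraph hk).copyCount_le_exN)
  have hx : (n : ℝ) ^ (1 - δ) ≤ R / n := by
    rw [le_div_iff₀ hn0]
    calc
      _ = (n : ℝ) ^ (1 - δ + 1) := by rw [Real.rpow_add hn0, Real.rpow_one]
      _ ≤ R := by convert hR using 2; ring
  have hx' : (l + 2 : ℝ) ≤ R / n :=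
    hl.trans <| (Real.rpow_le_rpow_of_exponent_le hn1' (by linarith)).trans hx
  have hfac : (n : ℝ) ^ (1 - δ) ≤ ((3 * R / n - 2 + 1 - l : ℕ) : ℝ) := by
    have h1 : (3 * (R / n) : ℝ) < ((3 * R / n : ℕ) : ℝ) + 1 := by
      have := Nat.lt_div_mul_add (a := 3 * R) hn1
      rw [← mul_div_assoc, div_lt_iff₀ hn0, add_mul, one_mul]
      exact_mod_cast this
    have h2 : l + 2 ≤ 3 * R / n := by
      have : ((l + 2 : ℕ) : ℝ) < ((3 * R / n : ℕ) : ℝ) + 1 := by push_cast; linarith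
      exact Nat.lt_succ_iff.1 (by exact_mod_cast this)
    rw [show 3 * R / n - 2 + 1 - l = 3 * R / n - (l + 1) by lia, Nat.cast_sub (by lia)]
    push_cast
    linarith
  have hreal : (n : ℝ) ^ (2 - δ) * ((n : ℝ) ^ (1 - δ)) ^ l ≤
      (((l + 3) ^ (l + 3) : ℕ) : ℝ) * exN n (triangleWithLeaves l) (bookGraph k) := by
    calc
      _ ≤ (3 * R : ℝ) * ((3 * R / n - 2 + 1 - l : ℕ) : ℝ) ^ l := by
        gcongr
        linarith [Nat.cast_nonneg (α := ℝ) R]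
      _ ≤ _ := by
        rw [hedge] at hfinal
        exact_mod_cast hfinal
  have hCpos : (0 : ℝ) < (((l + 3) ^ (l + 3) : ℕ) : ℝ) := by positivity
  refine le_of_mul_le_mul_left (le_trans ?_ hreal) hCpos
  calc
    _ ≤ (n : ℝ) ^ (ε / 2) * (n : ℝ) ^ ((l : ℝ) + 2 - ε) := by gcongr
    _ = (n : ℝ) ^ ((l : ℝ) + 2 - ε / 2) := by rw [← Real.rpow_add hn0]; ring_nf
    _ ≤ (n : ℝ) ^ ((2 - δ) + (1 - δ) * l) :=
      Real.rpow_le_rpow_of_exponent_le hn1' (by linarith)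
    _ = _ := by rw [Real.rpow_add hn0, Real.rpow_mul hn0.le, Real.rpow_natCast]

/-- `n^{ℓ+2-o(1)} ≤ ex(n, T_ℓ, B_k) = o(n^{ℓ+2})`. -/
theorem stmt10 (l k : ℕ) (hl : 1 ≤ l) (hk : 2 ≤ k) :
    (∀ ε : ℝ, 0 < ε → ∃ N : ℕ, ∀ n ≥ N,
      (n : ℝ) ^ ((l : ℝ) + 2 - ε) ≤ (exN n (triangleWithLeaves l) (bookGraph k) : ℝ)) ∧
    Tendsto (fun n : ℕ =>
        (exN n (triangleWithLeaves l) (bookGraph k) : ℝ) / (n : ℝ) ^ (l + 2))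
      atTop (nhds 0) := by
  exact ⟨fun ε hε => eventually_atTop.1
    (eventually_rpow_le_exN_triangleWithLeaves_bookGraph l hk hε),
    tendsto_exN_triangleWithLeaves_bookGraph l k⟩
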